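/- Let f : ℝ^d → ℝ be convex, twice continuously differentiable with positive definite Hessian ∇²f(x) for every x, and semi-strongly self-concordant with constant L_semi > 0. Let x ∈ ℝ^d and let B_x be an (α̲, ᾱ)-relative inexact Hessian of f at x, with α_max := max(α̲, ᾱ). Then for every y ∈ ℝ^d: ‖∇Q̄_f(y;x) − ∇f(y)‖_{B_x}^* ≤ α_max ‖y − x‖_{B_x} + ((1 + ᾱ)^{3/2} L_semi / 2)‖y − x‖_{B_x}². -/

import Mathlib

open scoped RealInnerProductSpace

/-- The action of a `d × d` matrix on a vector of `EuclideanSpace ℝ (Fin d)`. -/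
noncomputable def mulV {d : ℕ} (B : Matrix (Fin d) (Fin d) ℝ)
    (v : EuclideanSpace ℝ (Fin d)) : EuclideanSpace ℝ (Fin d) :=
  (EuclideanSpace.equiv (Fin d) ℝ).symm (B.mulVec ((EuclideanSpace.equiv (Fin d) ℝ) v))

/-- The `B`-norm `‖h‖_B = ⟨h, B h⟩^{1/2}`. -/
noncomputable def normB {d : ℕ} (B : Matrix (Fin d) (Fin d) ℝ)
    (h : EuclideanSpace ℝ (Fin d)) : ℝ :=
  Real.sqrt ⟪h, mulV B h⟫

/-- The dual norm `‖g‖_B^* = ⟨g, B⁻¹ g⟩^{1/2}`. -/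
noncomputable def dualNormB {d : ℕ} (B : Matrix (Fin d) (Fin d) ℝ)
    (g : EuclideanSpace ℝ (Fin d)) : ℝ :=
  Real.sqrt ⟪g, mulV B⁻¹ g⟫

/-- The Hessian of `f` at `x`, as a `d × d` matrix (matrix of the Fréchet derivative
of the gradient). -/
noncomputable def hessM {d : ℕ} (f : EuclideanSpace ℝ (Fin d) → ℝ)
    (x : EuclideanSpace ℝ (Fin d)) : Matrix (Fin d) (Fin d) ℝ :=
  fun i j => (fderiv ℝ (gradient f) x (EuclideanSpace.single j (1 : ℝ))) i

/-- `f` is semi-strongly self-concordant with constant `Ls`: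
`‖(∇²f(y) − ∇²f(x)) h‖_{∇²f(x)}^* ≤ Ls ‖y − x‖_{∇²f(x)} ‖h‖_{∇²f(x)}` for all `x y h`. -/
def SemiStrongSelfConcordant {d : ℕ} (f : EuclideanSpace ℝ (Fin d) → ℝ) (Ls : ℝ) : Prop :=
  ∀ x y h : EuclideanSpace ℝ (Fin d),
    dualNormB (hessM f x) (mulV (hessM f y - hessM f x) h) ≤
      Ls * normB (hessM f x) (y - x) * normB (hessM f x) h

/-- `Bx` is an `(al, au)`-relative inexact Hessian of `f` at `x`:
`Bx` is symmetric positive definite, `0 ≤ al ≤ 1`, `0 ≤ au`, and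
`(1 − al) Bx ⪯ ∇²f(x) ⪯ (1 + au) Bx` in the Loewner order. -/
def RelInexactHessian {d : ℕ} (f : EuclideanSpace ℝ (Fin d) → ℝ)
    (x : EuclideanSpace ℝ (Fin d)) (al au : ℝ) (Bx : Matrix (Fin d) (Fin d) ℝ) : Prop :=
  0 ≤ al ∧ al ≤ 1 ∧ 0 ≤ au ∧ Bx.PosDef ∧
    (hessM f x - (1 - al) • Bx).PosSemidef ∧ ((1 + au) • Bx - hessM f x).PosSemidef

/-- The inexact second-order model
`Q̄_f(y;x) = f(x) + ⟨∇f(x), y − x⟩ + ½⟨B_x(y − x), y − x⟩`. -/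
noncomputable def Qbar {d : ℕ} (f : EuclideanSpace ℝ (Fin d) → ℝ)
    (Bx : Matrix (Fin d) (Fin d) ℝ) (x y : EuclideanSpace ℝ (Fin d)) : ℝ :=
  f x + ⟪gradient f x, y - x⟫ + (1 / 2) * ⟪mulV Bx (y - x), y - x⟫


theorem mulV_eq_lin {d : ℕ} (B : Matrix (Fin d) (Fin d) ℝ) (v : EuclideanSpace ℝ (Fin d)) :
    mulV B v = Matrix.toEuclideanLin B v := rfl

theorem inner_mulV {d : ℕ} (B : Matrix (Fin d) (Fin d) ℝ) (u v : EuclideanSpace ℝ (Fin d)) :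
    ⟪u, mulV B v⟫ = u.ofLp ⬝ᵥ B.mulVec v.ofLp := by
  rw [dotProduct_comm]
  rfl

theorem inner_mulV_symm {d : ℕ} (B : Matrix (Fin d) (Fin d) ℝ) (hB : B.IsHermitian)
    (u v : EuclideanSpace ℝ (Fin d)) : ⟪u, mulV B v⟫ = ⟪v, mulV B u⟫ := by
  have hB' : B.transpose = B := by
    have := hB.eq
    rwa [Matrix.conjTranspose_eq_transpose_of_trivial] at this
  rw [inner_mulV, inner_mulV, Matrix.dotProduct_mulVec, dotProduct_comm,
    ← Matrix.mulVec_transpose, hB']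

theorem psd_inner {d : ℕ} {B : Matrix (Fin d) (Fin d) ℝ} (hB : B.PosSemidef)
    (u : EuclideanSpace ℝ (Fin d)) : 0 ≤ ⟪u, mulV B u⟫ := by
  rw [inner_mulV]
  simpa using hB.dotProduct_mulVec_nonneg u.ofLp

theorem pd_inner {d : ℕ} {B : Matrix (Fin d) (Fin d) ℝ} (hB : B.PosDef)
    (u : EuclideanSpace ℝ (Fin d)) (hu : u ≠ 0) : 0 < ⟪u, mulV B u⟫ := by
  rw [inner_mulV]
  have : u.ofLp ≠ 0 := by simpa using hu
  simpa using hB.dotProduct_mulVec_pos this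

theorem mulV_sub_mat {d : ℕ} (A B : Matrix (Fin d) (Fin d) ℝ) (v : EuclideanSpace ℝ (Fin d)) :
    mulV (A - B) v = mulV A v - mulV B v := by
  simp [mulV_eq_lin]

theorem mulV_smul_mat {d : ℕ} (c : ℝ) (B : Matrix (Fin d) (Fin d) ℝ)
    (v : EuclideanSpace ℝ (Fin d)) : mulV (c • B) v = c • mulV B v := by
  simp [mulV_eq_lin]

theorem gen_cs {d : ℕ} {B M : Matrix (Fin d) (Fin d) ℝ} (hB : B.PosDef) (hM : M.IsHermitian)
    (a : ℝ) (h1 : ∀ w, ⟪w, mulV M w⟫ ≤ a * ⟪w, mulV B w⟫)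
    (h2 : ∀ w, -(a * ⟪w, mulV B w⟫) ≤ ⟪w, mulV M w⟫) (u v : EuclideanSpace ℝ (Fin d)) :
    ⟪v, mulV M u⟫ ≤ a * normB B u * normB B v := by
  by_cases hu : u = 0
  · subst hu; simp [normB, mulV_eq_lin]
  by_cases hv : v = 0
  · subst hv; simp [normB, mulV_eq_lin]
  have pu := pd_inner hB u hu
  have pv := pd_inner hB v hv
  have hP : 0 < normB B u := Real.sqrt_pos.2 pu
  have hQ : 0 < normB B v := Real.sqrt_pos.2 pv
  have hP2 : normB B u ^ 2 = ⟪u, mulV B u⟫ := Real.sq_sqrt pu.le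
  have hQ2 : normB B v ^ 2 = ⟪v, mulV B v⟫ := Real.sq_sqrt pv.le
  set P := normB B u
  set Q := normB B v
  have k1 := h1 (Q • u + P • v)
  have k2 := h2 (Q • u - P • v)
  have s1 := inner_mulV_symm M hM u v
  have s2 := inner_mulV_symm B hB.isHermitian u v
  simp only [mulV_eq_lin, map_add, map_sub, map_smul, inner_add_left, inner_add_right,
    inner_sub_left, inner_sub_right, inner_smul_left, inner_smul_right] at k1 k2 s1 s2 hP2 hQ2 ⊢
  simp only [conj_trivial, s1, s2, ← hP2, ← hQ2] at k1 k2
  have : (P * Q) * ⟪v, Matrix.toEuclideanLin M u⟫ ≤ (P * Q) * (a * P * Q) := by nlinarith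
  exact le_of_mul_le_mul_left this (by positivity)

theorem dual_le {d : ℕ} {B : Matrix (Fin d) (Fin d) ℝ} (hB : B.PosDef)
    (g : EuclideanSpace ℝ (Fin d)) (C : ℝ) (hC : 0 ≤ C) (h : ∀ v, ⟪v, g⟫ ≤ C * normB B v) :
    dualNormB B g ≤ C := by
  have hdet : IsUnit B.det := (Matrix.isUnit_iff_isUnit_det _).1 hB.isUnit
  have hinv : mulV B (mulV B⁻¹ g) = g := by
    ext i
    change (B.mulVec (B⁻¹.mulVec g.ofLp)) i = g.ofLp i
    rw [Matrix.mulVec_mulVec, Matrix.mul_nonsing_inv _ hdet, Matrix.one_mulVec]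
  have h0 := h (mulV B⁻¹ g)
  have e : normB B (mulV B⁻¹ g) = dualNormB B g := by
    unfold normB dualNormB
    rw [hinv, real_inner_comm]
  have hn : 0 ≤ ⟪g, mulV B⁻¹ g⟫ := psd_inner hB.inv.posSemidef g
  have sq : dualNormB B g ^ 2 = ⟪g, mulV B⁻¹ g⟫ := Real.sq_sqrt hn
  rw [e, real_inner_comm, ← sq] at h0
  have : 0 ≤ dualNormB B g := Real.sqrt_nonneg _
  nlinarith

theorem inner_le_dual {d : ℕ} {B : Matrix (Fin d) (Fin d) ℝ} (hB : B.PosDef)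
    (g v : EuclideanSpace ℝ (Fin d)) : ⟪v, g⟫ ≤ dualNormB B g * normB B v := by
  have hdet : IsUnit B.det := (Matrix.isUnit_iff_isUnit_det _).1 hB.isUnit
  have hinv : mulV B (mulV B⁻¹ g) = g := by
    ext i
    change (B.mulVec (B⁻¹.mulVec g.ofLp)) i = g.ofLp i
    rw [Matrix.mulVec_mulVec, Matrix.mul_nonsing_inv _ hdet, Matrix.one_mulVec]
  have e : normB B (mulV B⁻¹ g) = dualNormB B g := by
    unfold normB dualNormB
    rw [hinv, real_inner_comm]
  have := gen_cs hB hB.isHermitian 1 (fun w => by simp)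
    (fun w => by have := psd_inner hB.posSemidef w; linarith) (mulV B⁻¹ g) v
  rwa [hinv, e, one_mul] at this

theorem hess_apply {d : ℕ} (f : EuclideanSpace ℝ (Fin d) → ℝ)
    (x u : EuclideanSpace ℝ (Fin d)) : fderiv ℝ (gradient f) x u = mulV (hessM f x) u := by
  have : (fderiv ℝ (gradient f) x).toLinearMap = Matrix.toEuclideanLin (hessM f x) := by
    refine (EuclideanSpace.basisFun (Fin d) ℝ).toBasis.ext fun j => ?_
    ext i
    simp [hessM, Matrix.toLpLin_apply]
  exact congrArg (fun L => L u) this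

theorem normB_neg {d : ℕ} (B : Matrix (Fin d) (Fin d) ℝ) (v : EuclideanSpace ℝ (Fin d)) :
    normB B (-v) = normB B v := by
  simp [normB, mulV_eq_lin]

theorem normB_smul {d : ℕ} (B : Matrix (Fin d) (Fin d) ℝ) (v : EuclideanSpace ℝ (Fin d))
    (t : ℝ) (ht : 0 ≤ t) : normB B (t • v) = t * normB B v := by
  simp only [normB, mulV_eq_lin, map_smul, inner_smul_left, inner_smul_right, conj_trivial]
  rw [← mul_assoc, Real.sqrt_mul (by positivity), Real.sqrt_mul_self ht]

theorem grad_diff {d : ℕ} (f : EuclideanSpace ℝ (Fin d) → ℝ) (hC2 : ContDiff ℝ 2 f) :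
    Differentiable ℝ (gradient f) := by
  have h : Differentiable ℝ (fderiv ℝ f) :=
    (hC2.fderiv_right (m := 1) (by norm_num)).differentiable (by norm_num)
  exact (InnerProductSpace.toDual ℝ (EuclideanSpace ℝ (Fin d))).symm.toContinuousLinearEquiv.differentiable.comp h

theorem taylor {d : ℕ} (f : EuclideanSpace ℝ (Fin d) → ℝ) (hC2 : ContDiff ℝ 2 f)
    (hpd : ∀ x, (hessM f x).PosDef)
    (Ls : ℝ) (hssc : SemiStrongSelfConcordant f Ls)
    (x u v : EuclideanSpace ℝ (Fin d)) :
    ⟪v, gradient f x + mulV (hessM f x) u - gradient f (x + u)⟫ ≤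
      Ls / 2 * normB (hessM f x) u ^ 2 * normB (hessM f x) v := by
  set K := Ls * normB (hessM f x) u ^ 2 * normB (hessM f x) v with hK
  let φ : ℝ → ℝ := fun t =>
    ⟪v, t • mulV (hessM f x) u - gradient f (x + t • u)⟫ - K * (t ^ 2 / 2)
  have hd : ∀ t, HasDerivAt φ
      (⟪v, mulV (hessM f x) u - mulV (hessM f (x + t • u)) u⟫ - K * t) t := by
    intro t
    have h1 : HasDerivAt (fun t : ℝ => x + t • u) u t := by
      simpa using ((hasDerivAt_id t).smul_const u).const_add x
    have h2 := ((grad_diff f hC2 (x + t • u)).hasFDerivAt).comp_hasDerivAt t h1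
    rw [hess_apply] at h2
    have h3 : HasDerivAt (fun t : ℝ => t • mulV (hessM f x) u) (mulV (hessM f x) u) t := by
      simpa using (hasDerivAt_id t).smul_const (mulV (hessM f x) u)
    have h4 := ((innerSL ℝ v).hasFDerivAt).comp_hasDerivAt t (h3.sub h2)
    have h5 : HasDerivAt (fun t : ℝ => K * (t ^ 2 / 2)) (K * t) t := by
      have := ((hasDerivAt_pow 2 t).div_const 2).const_mul K
      refine this.congr_deriv ?_
      norm_num
    exact h4.sub h5
  have hanti : AntitoneOn φ (Set.Icc 0 1) := by
    apply antitoneOn_of_deriv_nonpos (convex_Icc 0 1)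
    · exact fun t _ => (hd t).continuousAt.continuousWithinAt
    · exact fun t _ => (hd t).differentiableAt.differentiableWithinAt
    · intro t ht
      rw [interior_Icc] at ht
      rw [(hd t).deriv]
      have a1 := inner_le_dual (hpd x) (mulV (hessM f (x + t • u) - hessM f x) u) (-v)
      have a2 := hssc x (x + t • u) u
      rw [add_sub_cancel_left, normB_smul _ _ _ ht.1.le] at a2
      rw [normB_neg] at a1
      have nv : 0 ≤ normB (hessM f x) v := Real.sqrt_nonneg _
      have a3 := mul_le_mul_of_nonneg_right a2 nv
      have a4 : ⟪-v, mulV (hessM f (x + t • u) - hessM f x) u⟫ =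
          ⟪v, mulV (hessM f x) u - mulV (hessM f (x + t • u)) u⟫ := by
        rw [mulV_sub_mat, inner_neg_left, ← inner_neg_right, neg_sub]
      rw [a4] at a1
      rw [hK]
      nlinarith
  have := hanti (by simp) (by simp) (zero_le_one' ℝ)
  simp only [φ, one_smul, zero_smul, add_zero, inner_sub_right, inner_zero_right] at this
  rw [inner_sub_right, inner_add_right]
  nlinarith

/-- bound on the dual `B_x`-norm of the model-gradient error
`∇Q̄_f(y;x) − ∇f(y) = ∇f(x) + B_x(y − x) − ∇f(y)`. -/
theorem stmt3 {d : ℕ} (f : EuclideanSpace ℝ (Fin d) → ℝ)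
    (hconv : ConvexOn ℝ Set.univ f) (hC2 : ContDiff ℝ 2 f)
    (hpd : ∀ x, (hessM f x).PosDef)
    (Ls : ℝ) (hLs : 0 < Ls) (hssc : SemiStrongSelfConcordant f Ls)
    (x : EuclideanSpace ℝ (Fin d)) (al au : ℝ) (Bx : Matrix (Fin d) (Fin d) ℝ)
    (hrel : RelInexactHessian f x al au Bx) :
    ∀ y : EuclideanSpace ℝ (Fin d),
      dualNormB Bx (gradient f x + mulV Bx (y - x) - gradient f y) ≤
        max al au * normB Bx (y - x) +
          (1 + au) ^ ((3 : ℝ) / 2) * Ls / 2 * (normB Bx (y - x)) ^ 2 := by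
  intro y
  obtain ⟨hal, hal1, hau, hB, hlo, hup⟩ := hrel
  obtain ⟨u, rfl⟩ : ∃ u, y = x + u := ⟨y - x, by simp⟩
  rw [add_sub_cancel_left]
  have nB : ∀ w, 0 ≤ normB Bx w := fun w => Real.sqrt_nonneg _
  have nH : ∀ w, 0 ≤ normB (hessM f x) w := fun w => Real.sqrt_nonneg _
  have hm : 0 ≤ max al au := le_max_of_le_left hal
  have hr : (0:ℝ) ≤ (1 + au) ^ ((3 : ℝ) / 2) := Real.rpow_nonneg (by linarith) _
  refine dual_le hB _ _ ?_ fun v => ?_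
  · have := nB u
    positivity
  have hcmp : ∀ w, normB (hessM f x) w ≤ Real.sqrt (1 + au) * normB Bx w := by
    intro w
    unfold normB
    rw [← Real.sqrt_mul (by linarith)]
    apply Real.sqrt_le_sqrt
    have := psd_inner hup w
    rw [mulV_sub_mat, mulV_smul_mat, inner_sub_right, inner_smul_right] at this
    linarith
  have t1 : ⟪v, mulV (Bx - hessM f x) u⟫ ≤ max al au * normB Bx u * normB Bx v := by
    apply gen_cs hB (hB.isHermitian.sub (hpd x).isHermitian)
    · intro w
      have := psd_inner hlo w
      have p := psd_inner hB.posSemidef w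
      rw [mulV_sub_mat, mulV_smul_mat, inner_sub_right, inner_smul_right] at this
      rw [mulV_sub_mat, inner_sub_right]
      have := mul_le_mul_of_nonneg_right (le_max_left al au) p
      linarith
    · intro w
      have := psd_inner hup w
      have p := psd_inner hB.posSemidef w
      rw [mulV_sub_mat, mulV_smul_mat, inner_sub_right, inner_smul_right] at this
      rw [mulV_sub_mat, inner_sub_right]
      have := mul_le_mul_of_nonneg_right (le_max_right al au) p
      linarith
  have t2 := taylor f hC2 hpd Ls hssc x u v
  have hs : (1 + au) ^ ((3 : ℝ) / 2) = Real.sqrt (1 + au) ^ 3 := by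
    rw [Real.sqrt_eq_rpow, ← Real.rpow_natCast, ← Real.rpow_mul (by linarith)]
    norm_num
  have t3 : Ls / 2 * normB (hessM f x) u ^ 2 * normB (hessM f x) v ≤
      Ls / 2 * (Real.sqrt (1 + au) * normB Bx u) ^ 2 * (Real.sqrt (1 + au) * normB Bx v) := by
    have := nH u
    have := nH v
    have := nB u
    gcongr
    · exact hcmp u
    · exact hcmp v
  have t4 : ⟪v, gradient f x + mulV Bx u - gradient f (x + u)⟫ =
      ⟪v, mulV (Bx - hessM f x) u⟫ +
      ⟪v, gradient f x + mulV (hessM f x) u - gradient f (x + u)⟫ := by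
    rw [← inner_add_right, mulV_sub_mat]
    congr 1
    abel
  rw [t4, hs]
  calc _ ≤ _ := add_le_add t1 (t2.trans t3)
    _ = _ := by ring
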